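/- There is no pair (i, a) with 2 ≤ i ≤ 2^{11} - 2, i not a power of 2, and a ∈ F_{2^{11}}^* such that x^i + a·x permutes F_{2^{11}}. -/

import Mathlib

/-- All sums of sublists of `l`, listed with multiplicity. -/
def subsetSums : List ℕ → List ℕ
  | [] => [0]
  | b :: l => subsetSums l ++ (subsetSums l).map (b + ·)

theorem le_sum_of_mem_subsetSums {l : List ℕ} {j : ℕ} (hj : j ∈ subsetSums l) : j ≤ l.sum := by
  induction l generalizing j with
  | nil => simpa [subsetSums] using hj
  | cons b l ih =>
    simp only [subsetSums, List.mem_append, List.mem_map] at hj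
    rw [List.sum_cons]
    obtain hj | ⟨j', hj', rfl⟩ := hj
    · exact (ih hj).trans (Nat.le_add_left _ _)
    · exact Nat.add_le_add_left (ih hj') b

/-- In characteristic two, the expansion of a power of a binomial whose exponent is written as a
sum of powers of two. -/
theorem add_pow_list_sum {R : Type*} [CommRing R] [CharP R 2] (u v : R) {l : List ℕ}
    (hl : ∀ b ∈ l, ∃ e, b = 2 ^ e) :
    (u + v) ^ l.sum = ((subsetSums l).map fun j => u ^ j * v ^ (l.sum - j)).sum := by
  induction l with
  | nil => simp [subsetSums]
  | cons b l ih =>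
    obtain ⟨e, he⟩ := hl b List.mem_cons_self
    have hb : (u + v) ^ b = v ^ b + u ^ b := by
      rw [he, add_pow_char_pow, add_comm]
    rw [List.sum_cons, pow_add, ih fun c hc => hl c (List.mem_cons_of_mem _ hc), hb, add_mul,
      subsetSums, List.map_append, List.sum_append, List.map_map, ← List.sum_map_mul_left,
      ← List.sum_map_mul_left]
    congr 2
    · refine List.map_congr_left fun j hj => ?_
      rw [Nat.add_sub_assoc (le_sum_of_mem_subsetSums hj), pow_add]
      ring
    · refine List.map_congr_left fun j _ => ?_
      simp only [Function.comp_apply]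
      rw [Nat.add_sub_add_left, pow_add]
      ring

theorem sum_pow_eq_ite {F : Type*} [Field F] [Fintype F] {e : ℕ} (he : e ≠ 0) :
    ∑ x : F, x ^ e = if Fintype.card F - 1 ∣ e then -1 else 0 := by
  classical
  rw [← FiniteField.sum_pow_units F e, ← Finset.sum_subset (Finset.subset_univ {x : F | x ≠ 0})]
  · refine (Finset.sum_bij (fun (u : Fˣ) _ => (u : F)) ?_ ?_ ?_ ?_).symm
    · simp
    · exact fun a _ b _ h => Units.ext h
    · exact fun b hb => ⟨Units.mk0 b (by simpa using hb), Finset.mem_univ _, rfl⟩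
    · simp
  · intro x _ hx
    have : x = 0 := by simpa using hx
    rw [this, zero_pow he]

/-- The exponents of `a` in the coefficient relation obtained by applying Hermite's criterion with
the power `l.sum` to the polynomial `x ^ (r + 1) + a * x` over the field with `N + 1` elements. -/
def hermiteExponents (N r : ℕ) (l : List ℕ) : List ℕ :=
  ((subsetSums l).filter fun j => N ∣ r * j + l.sum).map (l.sum - ·)

theorem List.sum_map_ite_zero {α M : Type*} [AddMonoid M] (p : α → Prop) [DecidablePred p]
    (f : α → M) (l : List α) :
    (l.map fun x => if p x then f x else 0).sum = ((l.filter fun x => p x).map f).sum := by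
  induction l with
  | nil => rfl
  | cons b l ih => by_cases h : p b <;> simp [h, ih]

theorem sum_hermiteExponents_eq_zero {F : Type*} [Field F] [Fintype F] [CharP F 2] {N r : ℕ}
    (hN : Fintype.card F = N + 1) {a : F}
    (hf : Function.Bijective fun x : F => x ^ (r + 1) + a * x) {l : List ℕ}
    (hl : ∀ b ∈ l, ∃ e, b = 2 ^ e) (h0 : l.sum ≠ 0) (hlN : l.sum < N) :
    ((hermiteExponents N r l).map (a ^ ·)).sum = 0 := by
  have hsum : ∑ x : F, (x ^ (r + 1) + a * x) ^ l.sum = 0 := by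
    rw [hf.sum_comp fun y => y ^ l.sum]
    exact FiniteField.sum_pow_lt_card_sub_one F _ (by omega)
  have hterm : ∀ x : F, (x ^ (r + 1) + a * x) ^ l.sum =
      ((subsetSums l).map fun j => a ^ (l.sum - j) * x ^ (r * j + l.sum)).sum := by
    intro x
    rw [add_pow_list_sum _ _ hl]
    refine congrArg List.sum (List.map_congr_left fun j hj => ?_)
    obtain ⟨c, hc⟩ := Nat.exists_eq_add_of_le (le_sum_of_mem_subsetSums hj)
    rw [hc, Nat.add_sub_cancel_left, mul_pow]
    ring
  have hswap : ∀ L : List ℕ, ∑ x : F, (L.map fun j => a ^ (l.sum - j) * x ^ (r * j + l.sum)).sum =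
      (L.map fun j => if N ∣ r * j + l.sum then a ^ (l.sum - j) else 0).sum := by
    intro L
    induction L with
    | nil => simp
    | cons j L ih =>
      simp only [List.map_cons, List.sum_cons, Finset.sum_add_distrib, ih]
      rw [← Finset.mul_sum, sum_pow_eq_ite (by omega), hN, Nat.add_sub_cancel, CharTwo.neg_eq]
      simp
  rw [Finset.sum_congr rfl fun x _ => hterm x, hswap, List.sum_map_ite_zero] at hsum
  rwa [hermiteExponents, List.map_map]

/-- A nonzero element killed by `(q - 1) / gcd (r, q - 1)` is an `r`-th power. -/
theorem exists_pow_eq_of_pow_eq_one {F : Type*} [Field F] [Fintype F] {r n : ℕ}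
    (hn : r.gcd (Fintype.card F - 1) * n = Fintype.card F - 1) {a : F} (ha : a ≠ 0)
    (han : a ^ n = 1) : ∃ x : F, x ≠ 0 ∧ x ^ r = a := by
  classical
  set N := Fintype.card F - 1 with hN
  have hNpos : 0 < N := by have := Fintype.one_lt_card (α := F); omega
  have hcard : Nat.card Fˣ = N := by rw [Nat.card_eq_fintype_card, Fintype.card_units]
  obtain ⟨g, hg⟩ := IsCyclic.exists_generator (α := Fˣ)
  have hord : orderOf g = N := by rw [orderOf_eq_card_of_forall_mem_zpowers hg, hcard]
  obtain ⟨s, hs⟩ := hg (Units.mk0 a ha)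
  have hs' : g ^ s = Units.mk0 a ha := hs
  have hdvd : (N : ℤ) ∣ s * n := by
    rw [← hord, orderOf_dvd_iff_zpow_eq_one, zpow_mul, hs', zpow_natCast]
    ext
    simpa using han
  have hn0 : (n : ℤ) ≠ 0 := by
    rintro h
    rw [Nat.cast_eq_zero.mp h] at hn
    omega
  obtain ⟨s', rfl⟩ : ((r.gcd N : ℕ) : ℤ) ∣ s := by
    refine Int.dvd_of_mul_dvd_mul_right hn0 ?_
    rwa [← Nat.cast_mul, hn]
  refine ⟨((g ^ (r.gcdA N * s') : Fˣ) : F), Units.ne_zero _, ?_⟩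
  have : (g ^ (r.gcdA N * s')) ^ r = Units.mk0 a ha := by
    rw [← hs', Nat.gcd_eq_gcd_ab, ← zpow_natCast, ← zpow_mul, add_mul, zpow_add,
      mul_assoc (N : ℤ), zpow_mul g (N : ℤ), zpow_natCast g N, ← hord, pow_orderOf_eq_one, one_zpow,
      mul_one]
    congr 1
    ring
  simpa using congrArg Units.val this

theorem pow_ne_one_of_bijective {F : Type*} [Field F] [Fintype F] [CharP F 2] {r n : ℕ}
    (hn : r.gcd (Fintype.card F - 1) * n = Fintype.card F - 1) {a : F} (ha : a ≠ 0)
    (hf : Function.Bijective fun x : F => x ^ (r + 1) + a * x) : a ^ n ≠ 1 := by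
  intro han
  obtain ⟨x, hx, hxa⟩ := exists_pow_eq_of_pow_eq_one hn ha han
  refine hx (hf.injective ?_)
  simp [pow_succ, hxa, CharTwo.add_self_eq_zero]

/-- The relation with exponents `L` has one term, or two terms `a ^ s` and `a ^ t` for which
`a ^ s = a ^ t` forces `a ^ n = 1` in a field with `N + 1` elements. -/
def IsShort (N n : ℕ) : List ℕ → Prop
  | [_] => True
  | [s, t] => s < t ∧ (t - s).gcd N = n ∨ t < s ∧ (s - t).gcd N = n
  | _ => False

instance (N n : ℕ) : DecidablePred (IsShort N n)
  | [] => inferInstanceAs (Decidable False)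
  | [_] => inferInstanceAs (Decidable True)
  | [s, t] => inferInstanceAs
      (Decidable (s < t ∧ (t - s).gcd N = n ∨ t < s ∧ (s - t).gcd N = n))
  | _ :: _ :: _ :: _ => inferInstanceAs (Decidable False)

theorem pow_eq_one_of_pow_eq_pow {M : Type*} [MonoidWithZero M] [IsCancelMulZero M] {a : M} (ha : a ≠ 0)
    {N s t : ℕ} (haN : a ^ N = 1) (hst : s < t) (h : a ^ s = a ^ t) :
    a ^ (t - s).gcd N = 1 := by
  refine pow_gcd_eq_one.2 ⟨mul_left_cancel₀ (pow_ne_zero s ha) ?_, haN⟩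
  rw [← pow_add, Nat.add_sub_cancel' hst.le, mul_one, h]

theorem pow_eq_one_of_isShort {F : Type*} [Field F] [CharP F 2] {N n : ℕ} {a : F} (ha : a ≠ 0)
    (haN : a ^ N = 1) {L : List ℕ} (hL : IsShort N n L) (h : (L.map (a ^ ·)).sum = 0) :
    a ^ n = 1 := by
  match L, hL with
  | [s], _ => simp [ha] at h
  | [s, t], hL =>
    have hst : a ^ s = a ^ t := by simpa [CharTwo.add_eq_zero] using h
    obtain ⟨hlt, rfl⟩ | ⟨hlt, rfl⟩ := hL
    · exact pow_eq_one_of_pow_eq_pow ha haN hlt hst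
    · exact pow_eq_one_of_pow_eq_pow ha haN hlt hst.symm

theorem sum_pow_eq_zero_of_sum_shift {F : Type*} [Field F] {a : F} (ha : a ≠ 0) {c n : ℕ}
    {T : List ℕ} (h : ((T.map fun t => c + n * t).map (a ^ ·)).sum = 0) :
    (T.map ((a ^ n) ^ ·)).sum = 0 := by
  refine (mul_eq_zero.1 ?_).resolve_left (pow_ne_zero c ha)
  rw [← h, ← List.sum_map_mul_left, List.map_map]
  refine congrArg List.sum (List.map_congr_left fun t _ => ?_)
  simp [pow_add, pow_mul]

/-- The lists of exponents occurring in the long relations for the multiples of `89`. -/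
def longExponents : List (List ℕ) :=
  [[17, 13, 12, 5, 1, 0], [17, 16, 12, 5, 1, 0], [12, 11, 7, 0], [17, 16, 12, 5, 4, 0],
    [12, 5, 1, 0], [19, 12, 11, 8, 7, 0], [17, 16, 9, 5, 4, 0], [17, 13, 12, 8, 1, 0]]

theorem eq_one_of_mem_longExponents {F : Type*} [Field F] [CharP F 2] {b : F} (hb : b ^ 89 = 1)
    {T : List ℕ} (hT : T ∈ longExponents) (h : (T.map (b ^ ·)).sum = 0) : b = 1 := by
  simp only [longExponents, List.mem_cons, List.not_mem_nil, or_false] at hT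
  obtain rfl | rfl | rfl | rfl | rfl | rfl | rfl | rfl := hT <;>
    simp only [List.map_cons, List.map_nil, List.sum_cons, List.sum_nil] at h <;> grind

theorem eq_one_of_pow_twentythree {F : Type*} [Field F] [CharP F 2] {b : F} (hb : b ^ 23 = 1)
    (h : ([7, 5, 2, 0].map (b ^ ·)).sum = 0) : b = 1 := by
  simp only [List.map_cons, List.map_nil, List.sum_cons, List.sum_nil] at h
  grind

theorem hermiteExponents_twentythree : ∀ k < 89, 0 < k → k ≠ 27 →
    ∃ s ∈ [[0, 1, 2, 4], [0, 2, 6], [0, 1, 4, 5, 6], [0, 1, 2, 3, 6, 7], [0, 2, 3, 4, 5, 6, 7],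
      [0, 1, 3, 5, 8], [0, 2, 4, 5, 7, 8], [0, 1, 2, 4, 5, 6, 7, 9]],
      (s.map (2 ^ ·)).sum ≠ 0 ∧ (s.map (2 ^ ·)).sum < 2047 ∧
      IsShort 2047 89 (hermiteExponents 2047 (23 * k) (s.map (2 ^ ·))) := by
  decide +kernel

theorem hermiteExponents_twentythree_mul_twentyseven :
    hermiteExponents 2047 (23 * 27) ([9, 7, 6, 5, 4, 2, 1, 0].map (2 ^ ·)) =
      [7, 5, 2, 0].map fun t => 68 + 89 * t := by
  decide +kernel

theorem hermiteExponents_eightynine : ∀ k < 23, 0 < k →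
    IsShort 2047 23 (hermiteExponents 2047 (89 * k) ([6, 4, 3, 0].map (2 ^ ·))) ∨
    ∃ c < 158, ∃ T ∈ longExponents,
      hermiteExponents 2047 (89 * k) ([8, 7, 5, 4, 3, 2, 0].map (2 ^ ·)) =
        T.map fun t => c + 23 * t := by
  decide +kernel

theorem stmt18 (F : Type*) [Field F] [Fintype F] (hF : Fintype.card F = 2 ^ 11) :
    ¬ ∃ (i : ℕ) (a : F), 2 ≤ i ∧ i ≤ 2 ^ 11 - 2 ∧ (¬ ∃ j : ℕ, i = 2 ^ j) ∧ a ≠ 0 ∧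
        Function.Bijective (fun x : F => x ^ i + a * x) := by
  rintro ⟨i, a, hi, hi', -, ha, hf⟩
  obtain ⟨r, rfl⟩ : ∃ r, i = r + 1 := ⟨i - 1, by omega⟩
  have : CharP F 2 := charP_of_card_eq_prime_pow hF
  have hN : Fintype.card F = 2047 + 1 := hF
  have haN : a ^ 2047 = 1 := by simpa [hN] using FiniteField.pow_card_sub_one_eq_one a ha
  have hne : ∀ n, r.gcd 2047 * n = 2047 → a ^ n ≠ 1 := fun n hn =>
    pow_ne_one_of_bijective (by simpa [hN] using hn) ha hf
  have hrel : ∀ s : List ℕ, (s.map (2 ^ ·)).sum ≠ 0 → (s.map (2 ^ ·)).sum < 2047 →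
      ((hermiteExponents 2047 r (s.map (2 ^ ·))).map (a ^ ·)).sum = 0 := fun s =>
    sum_hermiteExponents_eq_zero hN hf fun b hb => by
      obtain ⟨e, -, rfl⟩ := List.mem_map.1 hb
      exact ⟨e, rfl⟩
  have hdiv : r.gcd 2047 ∈ Nat.divisors 2047 :=
    Nat.mem_divisors.2 ⟨Nat.gcd_dvd_right _ _, by norm_num⟩
  rw [show Nat.divisors 2047 = {1, 23, 89, 2047} by decide +kernel] at hdiv
  simp only [Finset.mem_insert, Finset.mem_singleton] at hdiv
  obtain ⟨k, hk⟩ := Nat.gcd_dvd_left r 2047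
  obtain h | h | h | h := hdiv
  · exact hne 2047 (by rw [h]) haN
  · have ha89 : a ^ 89 ≠ 1 := hne 89 (by rw [h])
    rw [h] at hk
    subst hk
    by_cases hk27 : k = 27
    · subst hk27
      have hsum := hrel [9, 7, 6, 5, 4, 2, 1, 0] (by decide) (by decide)
      rw [hermiteExponents_twentythree_mul_twentyseven] at hsum
      exact ha89 (eq_one_of_pow_twentythree (by rw [← pow_mul, haN])
        (sum_pow_eq_zero_of_sum_shift ha hsum))
    · obtain ⟨s, -, h0, hlt, hs⟩ := hermiteExponents_twentythree k (by omega) (by omega) hk27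
      exact ha89 (pow_eq_one_of_isShort ha haN hs (hrel s h0 hlt))
  · have ha23 : a ^ 23 ≠ 1 := hne 23 (by rw [h])
    rw [h] at hk
    subst hk
    obtain hs | ⟨c, -, T, hT, hcT⟩ := hermiteExponents_eightynine k (by omega) (by omega)
    · exact ha23 (pow_eq_one_of_isShort ha haN hs (hrel _ (by decide) (by decide)))
    · have hsum := hrel [8, 7, 5, 4, 3, 2, 0] (by decide) (by decide)
      rw [hcT] at hsum
      exact ha23 (eq_one_of_mem_longExponents (by rw [← pow_mul, haN]) hT
        (sum_pow_eq_zero_of_sum_shift ha hsum))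
  · have := Nat.le_of_dvd (by omega) (h ▸ Nat.gcd_dvd_left r 2047)
    omega
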